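/- (One-step ascent of sign-SGA) Let φ ∈ L¹(ν) ∩ L^∞(𝒴) with J(φ) finite, let η > 0, and set φ' := φ + η · ‖δJ(φ)‖_{L¹(𝒴)} · sign(δJ(φ)), where ‖f‖_{L¹(𝒴)} := ∫_𝒴 |f(y)| dy and sign(f)(y) ∈ {−1,0,1} is the pointwise sign of f(y). Then φ' ∈ L¹(ν) ∩ L^∞(𝒴) and J(φ') ≥ J(φ) + (η − η²/2) · ‖δJ(φ)‖²_{L¹(𝒴)}; moreover ‖δJ(φ)‖_{L¹(𝒴)} ≤ 2. -/

import Mathlib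

open MeasureTheory

noncomputable section

variable {d : ℕ}

/-- `φ⁺(x) = log ∫ exp(φ(y) - c(x,y)/ε) dν(y)`, with `ν` the density of the marginal on `𝒴`. -/
def phiPlus (ν : (Fin d → ℝ) → ℝ) (c : (Fin d → ℝ) → (Fin d → ℝ) → ℝ) (ε : ℝ)
    (φ : (Fin d → ℝ) → ℝ) (x : Fin d → ℝ) : ℝ :=
  Real.log (∫ y, Real.exp (φ y - c x y / ε) * ν y)

/-- The semi-dual `J(φ) = ∫ φ dν - ∫ φ⁺ dμ`. -/
def semiDual (μ ν : (Fin d → ℝ) → ℝ) (c : (Fin d → ℝ) → (Fin d → ℝ) → ℝ) (ε : ℝ)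
    (φ : (Fin d → ℝ) → ℝ) : ℝ :=
  (∫ y, φ y * ν y) - ∫ x, phiPlus ν c ε φ x * μ x

/-- The joint density `π(φ, φ⁺)(x,y) = exp(φ(y) - φ⁺(x) - c(x,y)/ε) μ(x) ν(y)`. -/
def piJoint (μ ν : (Fin d → ℝ) → ℝ) (c : (Fin d → ℝ) → (Fin d → ℝ) → ℝ) (ε : ℝ)
    (φ : (Fin d → ℝ) → ℝ) (z : (Fin d → ℝ) × (Fin d → ℝ)) : ℝ :=
  Real.exp (φ z.2 - phiPlus ν c ε φ z.1 - c z.1 z.2 / ε) * μ z.1 * ν z.2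

/-- The `𝒴`-marginal density of `π(φ, φ⁺)`. -/
def piY (μ ν : (Fin d → ℝ) → ℝ) (c : (Fin d → ℝ) → (Fin d → ℝ) → ℝ) (ε : ℝ)
    (φ : (Fin d → ℝ) → ℝ) (y : Fin d → ℝ) : ℝ :=
  ∫ x, piJoint μ ν c ε φ (x, y)

/-- First variation of the semi-dual: `δJ(φ) = ν - π(φ,φ⁺)_𝒴`. -/
def deltaJ (μ ν : (Fin d → ℝ) → ℝ) (c : (Fin d → ℝ) → (Fin d → ℝ) → ℝ) (ε : ℝ)
    (φ : (Fin d → ℝ) → ℝ) (y : Fin d → ℝ) : ℝ :=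
  ν y - piY μ ν c ε φ y

/-- The sign-SGA update `φ' = φ + η ‖δJ(φ)‖_{L¹(𝒴)} sign(δJ(φ))`. -/
def signSGA (μ ν : (Fin d → ℝ) → ℝ) (c : (Fin d → ℝ) → (Fin d → ℝ) → ℝ) (ε : ℝ)
    (φ : (Fin d → ℝ) → ℝ) (η : ℝ) (y : Fin d → ℝ) : ℝ :=
  φ y + η * (∫ y', |deltaJ μ ν c ε φ y'|) * Real.sign (deltaJ μ ν c ε φ y)

/-- **Hoeffding's lemma** for a probability density `p` and a bounded function `h`. -/
theorem log_integral_exp_mul_density_le {α : Type*} [MeasurableSpace α] {m : Measure α}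
    {p h : α → ℝ} (hp : Measurable p) (hp0 : ∀ y, 0 ≤ p y) (hp1 : ∫ y, p y ∂m = 1)
    (hh : Measurable h) {H : ℝ} (hH : ∀ y, |h y| ≤ H) :
    Real.log (∫ y, Real.exp (h y) * p y ∂m) ≤ (∫ y, h y * p y ∂m) + H ^ 2 / 2 := by
  have hpi : Integrable p m := by
    by_contra hn
    rw [integral_undef hn] at hp1
    exact zero_ne_one hp1
  set P : Measure α := m.withDensity fun y => ENNReal.ofReal (p y) with hP
  have hint (f : α → ℝ) : ∫ y, f y ∂P = ∫ y, f y * p y ∂m := by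
    rw [hP, integral_withDensity_eq_integral_toReal_smul hp.ennreal_ofReal (by simp)]
    refine integral_congr_ae (.of_forall fun y => ?_)
    simp [ENNReal.toReal_ofReal (hp0 y), mul_comm]
  have : IsProbabilityMeasure P := by
    refine ⟨?_⟩
    rw [hP, withDensity_apply _ MeasurableSet.univ, Measure.restrict_univ,
      ← ofReal_integral_eq_lintegral_ofReal hpi (.of_forall hp0), hp1, ENNReal.ofReal_one]
  have hsub := (ProbabilityTheory.hasSubgaussianMGF_of_mem_Icc (μ := P) (X := h) (a := -H)
    (b := H) hh.aemeasurable (.of_forall fun y => abs_le.mp (hH y))).mgf_le 1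
  simp only [ProbabilityTheory.mgf, one_mul, Real.exp_sub, integral_div] at hsub
  rw [div_le_iff₀ (Real.exp_pos _), ← Real.exp_add, hint, hint] at hsub
  have hpos : 0 < ∫ y, Real.exp (h y) * p y ∂m := by
    rw [← hint]
    exact integral_exp_pos (Integrable.of_bound (Real.measurable_exp.comp hh).aestronglyMeasurable
      (Real.exp H) (.of_forall fun y => by
        rw [Real.norm_eq_abs, Real.abs_exp, Real.exp_le_exp]; exact (le_abs_self _).trans (hH y)))
  refine (Real.log_le_iff_le_exp hpos).mpr (hsub.trans (Real.exp_le_exp.mpr (le_of_eq ?_)))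
  simp only [NNReal.coe_pow, NNReal.coe_div, coe_nnnorm, NNReal.coe_ofNat, Real.norm_eq_abs,
    div_pow, sq_abs]
  ring

/-- Averages of `exp h` under a probability density have logarithm at most `sup |h|`. -/
theorem abs_log_integral_exp_mul_density_le {α : Type*} [MeasurableSpace α] {m : Measure α}
    {p h : α → ℝ} (hp0 : ∀ y, 0 ≤ p y) (hp1 : ∫ y, p y ∂m = 1)
    (hi : Integrable (fun y => Real.exp (h y) * p y) m) {H : ℝ} (hH : ∀ y, |h y| ≤ H) :
    |Real.log (∫ y, Real.exp (h y) * p y ∂m)| ≤ H := by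
  have hpi : Integrable p m := by
    by_contra hn
    rw [integral_undef hn] at hp1
    exact zero_ne_one hp1
  have h1 : Real.exp (-H) ≤ ∫ y, Real.exp (h y) * p y ∂m := by
    have := integral_mono (hpi.const_mul (Real.exp (-H))) hi fun y =>
      mul_le_mul_of_nonneg_right (Real.exp_le_exp.mpr (abs_le.mp (hH y)).1) (hp0 y)
    rwa [integral_const_mul, hp1, mul_one] at this
  have h2 : ∫ y, Real.exp (h y) * p y ∂m ≤ Real.exp H := by
    have := integral_mono hi (hpi.const_mul (Real.exp H)) fun y =>
      mul_le_mul_of_nonneg_right (Real.exp_le_exp.mpr (abs_le.mp (hH y)).2) (hp0 y)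
    rwa [integral_const_mul, hp1, mul_one] at this
  have hpos := (Real.exp_pos _).trans_le h1
  exact abs_le.mpr ⟨(Real.le_log_iff_exp_le hpos).mpr h1, (Real.log_le_iff_le_exp hpos).mpr h2⟩

theorem Real.measurable_sign : Measurable Real.sign :=
  Measurable.ite measurableSet_Iio measurable_const
    (Measurable.ite measurableSet_Ioi measurable_const measurable_const)

theorem Real.sign_mul_self_eq_abs (r : ℝ) : Real.sign r * r = |r| := by
  rcases lt_trichotomy r 0 with hr | rfl | hr
  · rw [Real.sign_of_neg hr, abs_of_neg hr, neg_one_mul]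
  · simp
  · rw [Real.sign_of_pos hr, abs_of_pos hr, one_mul]

theorem Real.abs_sign_le_one (r : ℝ) : |Real.sign r| ≤ 1 := by
  rcases Real.sign_apply_eq r with h | h | h <;> simp [h]

section Gibbs

variable {d : ℕ} {μ ν : (Fin d → ℝ) → ℝ} {c : (Fin d → ℝ) → (Fin d → ℝ) → ℝ} {ε : ℝ}
  {φ h : (Fin d → ℝ) → ℝ}

/-- The conditional density of `y` given `x` under `π(φ, φ⁺)`. -/
def condDensity (ν : (Fin d → ℝ) → ℝ) (c : (Fin d → ℝ) → (Fin d → ℝ) → ℝ) (ε : ℝ)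
    (φ : (Fin d → ℝ) → ℝ) (x y : Fin d → ℝ) : ℝ :=
  Real.exp (φ y - phiPlus ν c ε φ x - c x y / ε) * ν y

theorem piJoint_eq (x y : Fin d → ℝ) :
    piJoint μ ν c ε φ (x, y) = condDensity ν c ε φ x y * μ x := by
  simp only [piJoint, condDensity]; ring

theorem condDensity_nonneg (hν0 : ∀ y, 0 ≤ ν y) (x y : Fin d → ℝ) :
    0 ≤ condDensity ν c ε φ x y := mul_nonneg (Real.exp_pos _).le (hν0 y)

theorem condDensity_eq_div {x : Fin d → ℝ}
    (hpos : 0 < ∫ y, Real.exp (φ y - c x y / ε) * ν y) (y : Fin d → ℝ) :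
    condDensity ν c ε φ x y =
      Real.exp (φ y - c x y / ε) * ν y / ∫ y, Real.exp (φ y - c x y / ε) * ν y := by
  rw [condDensity, sub_right_comm, Real.exp_sub, phiPlus, Real.exp_log hpos]
  ring

theorem integral_condDensity {x : Fin d → ℝ}
    (hpos : 0 < ∫ y, Real.exp (φ y - c x y / ε) * ν y) :
    ∫ y, condDensity ν c ε φ x y = 1 := by
  simp_rw [condDensity_eq_div hpos]
  rw [integral_div, div_self hpos.ne']

theorem integrable_condDensity {x : Fin d → ℝ}
    (hpos : 0 < ∫ y, Real.exp (φ y - c x y / ε) * ν y) :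
    Integrable (condDensity ν c ε φ x) := by
  by_contra hn
  exact zero_ne_one ((integral_undef hn).symm.trans (integral_condDensity hpos))

theorem measurable_phiPlus (hνm : Measurable ν) (hc : Measurable (Function.uncurry c))
    (hφm : Measurable φ) : Measurable (phiPlus ν c ε φ) := by
  have hg : Measurable fun z : (Fin d → ℝ) × (Fin d → ℝ) =>
      Real.exp (φ z.2 - c z.1 z.2 / ε) * ν z.2 :=
    (Real.measurable_exp.comp ((hφm.comp measurable_snd).sub (hc.div_const ε))).mul
      (hνm.comp measurable_snd)
  exact Real.measurable_log.comp hg.stronglyMeasurable.integral_prod_right.measurable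

theorem measurable_condDensity (hνm : Measurable ν) (hc : Measurable (Function.uncurry c))
    (hφm : Measurable φ) : Measurable (Function.uncurry (condDensity ν c ε φ)) :=
  (Real.measurable_exp.comp (((hφm.comp measurable_snd).sub
    ((measurable_phiPlus hνm hc hφm).comp measurable_fst)).sub (hc.div_const ε))).mul
      (hνm.comp measurable_snd)

theorem measurable_piJoint (hμm : Measurable μ) (hνm : Measurable ν)
    (hc : Measurable (Function.uncurry c)) (hφm : Measurable φ) :
    Measurable (piJoint μ ν c ε φ) := by
  convert (measurable_condDensity (ε := ε) hνm hc hφm).mul (hμm.comp measurable_fst) using 1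
  ext ⟨x, y⟩
  exact piJoint_eq x y

theorem measurable_deltaJ (hμm : Measurable μ) (hνm : Measurable ν)
    (hc : Measurable (Function.uncurry c)) (hφm : Measurable φ) :
    Measurable (deltaJ μ ν c ε φ) :=
  hνm.sub (measurable_piJoint hμm hνm hc hφm).stronglyMeasurable.integral_prod_left'.measurable

theorem integrable_piJoint (hμ0 : ∀ x, 0 ≤ μ x) (hν0 : ∀ y, 0 ≤ ν y)
    (hμm : Measurable μ) (hνm : Measurable ν) (hμi : Integrable μ)
    (hc : Measurable (Function.uncurry c)) (hφm : Measurable φ)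
    (hpos : ∀ x, 0 < ∫ y, Real.exp (φ y - c x y / ε) * ν y) :
    Integrable (piJoint μ ν c ε φ) (volume.prod volume) := by
  rw [integrable_prod_iff (measurable_piJoint hμm hνm hc hφm).aestronglyMeasurable]
  constructor
  · refine .of_forall fun x => ?_
    simp_rw [piJoint_eq]
    exact (integrable_condDensity (hpos x)).mul_const _
  · refine hμi.congr (.of_forall fun x => ?_)
    have hn (y) : ‖piJoint μ ν c ε φ (x, y)‖ = condDensity ν c ε φ x y * μ x := by
      rw [piJoint_eq, Real.norm_of_nonneg (mul_nonneg (condDensity_nonneg hν0 x y) (hμ0 x))]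
    simp only [hn]
    rw [integral_mul_const, integral_condDensity (hpos x), one_mul]

/-- Shifting the potential by `h` changes `φ⁺` by the log-average of `exp h` under the
conditional density. -/
theorem phiPlus_add {x : Fin d → ℝ} (hpos : 0 < ∫ y, Real.exp (φ y - c x y / ε) * ν y)
    (hne : ∫ y, Real.exp (h y) * condDensity ν c ε φ x y ≠ 0) :
    phiPlus ν c ε (fun y => φ y + h y) x =
      phiPlus ν c ε φ x + Real.log (∫ y, Real.exp (h y) * condDensity ν c ε φ x y) := by
  have key : ∫ y, Real.exp (φ y + h y - c x y / ε) * ν y =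
      (∫ y, Real.exp (φ y - c x y / ε) * ν y) *
        ∫ y, Real.exp (h y) * condDensity ν c ε φ x y := by
    rw [← integral_const_mul]
    refine integral_congr_ae (.of_forall fun y => ?_)
    beta_reduce
    rw [condDensity_eq_div hpos, show φ y + h y - c x y / ε = h y + (φ y - c x y / ε) by ring,
      Real.exp_add]
    field_simp
  rw [phiPlus, key, Real.log_mul hpos.ne' hne, phiPlus]

/-- A bounded perturbation `h` of the potential changes the semi-dual by at least
`∫ h δJ(φ) - H² / 2`, where `H` bounds `|h|`. -/
theorem semiDual_add_ge (hμ0 : ∀ x, 0 ≤ μ x) (hν0 : ∀ y, 0 ≤ ν y)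
    (hμm : Measurable μ) (hνm : Measurable ν) (hμ1 : ∫ x, μ x = 1) (hμi : Integrable μ)
    (hνi : Integrable ν) (hc : Measurable (Function.uncurry c)) (hφm : Measurable φ)
    (hφν : Integrable (fun y => φ y * ν y))
    (hpos : ∀ x, 0 < ∫ y, Real.exp (φ y - c x y / ε) * ν y)
    (hJ : Integrable (fun x => phiPlus ν c ε φ x * μ x))
    (hh : Measurable h) {H : ℝ} (hH : ∀ y, |h y| ≤ H) :
    semiDual μ ν c ε φ + (∫ y, h y * deltaJ μ ν c ε φ y) - H ^ 2 / 2 ≤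
      semiDual μ ν c ε (fun y => φ y + h y) := by
  have hcm := measurable_condDensity (ε := ε) hνm hc hφm
  have hpi := integrable_piJoint hμ0 hν0 hμm hνm hμi hc hφm hpos
  have hhν : Integrable fun y => h y * ν y :=
    hνi.bdd_mul hh.aestronglyMeasurable (.of_forall hH)
  have hhπ : Integrable (fun z : (Fin d → ℝ) × (Fin d → ℝ) => h z.2 * piJoint μ ν c ε φ z)
      (volume.prod volume) :=
    hpi.bdd_mul (hh.comp measurable_snd).aestronglyMeasurable (.of_forall fun z => hH z.2)
  have hhY : Integrable fun y => h y * piY μ ν c ε φ y :=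
    hpi.integral_prod_right.bdd_mul hh.aestronglyMeasurable (.of_forall hH)
  have hexp (x) : Integrable fun y => Real.exp (h y) * condDensity ν c ε φ x y :=
    (integrable_condDensity (hpos x)).bdd_mul (c := Real.exp H)
      (Real.measurable_exp.comp hh).aestronglyMeasurable (.of_forall fun y => by
        rw [Real.norm_eq_abs, Real.abs_exp, Real.exp_le_exp]; exact (le_abs_self _).trans (hH y))
  have hne (x) : ∫ y, Real.exp (h y) * condDensity ν c ε φ x y ≠ 0 := by
    have := integral_mono ((integrable_condDensity (hpos x)).const_mul (Real.exp (-H))) (hexp x)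
      fun y => mul_le_mul_of_nonneg_right (Real.exp_le_exp.mpr (abs_le.mp (hH y)).1)
        (condDensity_nonneg hν0 x y)
    rw [integral_const_mul, integral_condDensity (hpos x), mul_one] at this
    exact ((Real.exp_pos _).trans_le this).ne'
  set l : (Fin d → ℝ) → ℝ :=
    fun x => Real.log (∫ y, Real.exp (h y) * condDensity ν c ε φ x y) with hl
  have hlm : Measurable l := by
    have hg : Measurable fun z : (Fin d → ℝ) × (Fin d → ℝ) =>
        Real.exp (h z.2) * condDensity ν c ε φ z.1 z.2 :=
      (Real.measurable_exp.comp (hh.comp measurable_snd)).mul hcm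
    exact Real.measurable_log.comp hg.stronglyMeasurable.integral_prod_right.measurable
  have hli : Integrable fun x => l x * μ x :=
    hμi.bdd_mul hlm.aestronglyMeasurable (.of_forall fun x =>
      abs_log_integral_exp_mul_density_le (condDensity_nonneg hν0 x)
        (integral_condDensity (hpos x)) (hexp x) hH)
  have hplus : ∫ x, phiPlus ν c ε (fun y => φ y + h y) x * μ x =
      (∫ x, phiPlus ν c ε φ x * μ x) + ∫ x, l x * μ x := by
    rw [← integral_add hJ hli]
    exact integral_congr_ae (.of_forall fun x => by
      simp only [phiPlus_add (hpos x) (hne x), hl, add_mul])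
  have hlin : ∫ y, (φ y + h y) * ν y = (∫ y, φ y * ν y) + ∫ y, h y * ν y := by
    rw [← integral_add hφν hhν]
    simp only [add_mul]
  have hdelta : ∫ y, h y * deltaJ μ ν c ε φ y =
      (∫ y, h y * ν y) - ∫ y, h y * piY μ ν c ε φ y := by
    rw [← integral_sub hhν hhY]
    simp only [deltaJ, mul_sub]
  have hfub : ∫ y, h y * piY μ ν c ε φ y = ∫ x, ∫ y, h y * piJoint μ ν c ε φ (x, y) := by
    rw [integral_integral_swap hhπ]
    simp only [piY, integral_const_mul]
  have hle : ∫ x, l x * μ x ≤ (∫ y, h y * piY μ ν c ε φ y) + H ^ 2 / 2 := by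
    have hmono : ∫ x, l x * μ x ≤
        ∫ x, ((∫ y, h y * piJoint μ ν c ε φ (x, y)) + H ^ 2 / 2 * μ x) := by
      refine integral_mono hli (hhπ.integral_prod_left.add (hμi.const_mul _)) fun x => ?_
      have := mul_le_mul_of_nonneg_right (log_integral_exp_mul_density_le
        (hcm.comp measurable_prodMk_left) (condDensity_nonneg hν0 x)
        (integral_condDensity (hpos x)) hh hH) (hμ0 x)
      simp only [piJoint_eq, ← mul_assoc, integral_mul_const]
      rw [← add_mul]
      exact this
    rw [integral_add hhπ.integral_prod_left (hμi.const_mul _), integral_const_mul, hμ1,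
      mul_one, ← hfub] at hmono
    exact hmono
  simp only [semiDual]
  rw [hplus, hlin, hdelta]
  linarith

end Gibbs

/-- One-step ascent of sign-SGA.
For `φ ∈ L¹(ν) ∩ L^∞(𝒴)` and `η > 0`, the update `φ'` stays in `L¹(ν) ∩ L^∞(𝒴)` and
`J(φ') ≥ J(φ) + (η − η²/2) ‖δJ(φ)‖²_{L¹(𝒴)}`; moreover `‖δJ(φ)‖_{L¹(𝒴)} ≤ 2`. -/
theorem signSGA_one_step_ascent
    (μ ν : (Fin d → ℝ) → ℝ) (c : (Fin d → ℝ) → (Fin d → ℝ) → ℝ) (ε : ℝ)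
    (hε : 0 < ε) (hμ0 : ∀ x, 0 ≤ μ x) (hν0 : ∀ y, 0 ≤ ν y)
    (hμm : Measurable μ) (hνm : Measurable ν)
    (hμ1 : (∫ x, μ x) = 1) (hν1 : (∫ y, ν y) = 1)
    (hc : Measurable (Function.uncurry c))
    (φ : (Fin d → ℝ) → ℝ) (hφm : Measurable φ)
    (hφν : Integrable (fun y => φ y * ν y))
    (hφbdd : ∃ M, ∀ᵐ y ∂(volume : Measure (Fin d → ℝ)), |φ y| ≤ M)
    (η : ℝ) (hη : 0 < η)
    (hpos : ∀ x, 0 < ∫ y, Real.exp (φ y - c x y / ε) * ν y)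
    (hJ : Integrable (fun x => phiPlus ν c ε φ x * μ x)) :
    Integrable (fun y => signSGA μ ν c ε φ η y * ν y) ∧
    (∃ M, ∀ᵐ y ∂(volume : Measure (Fin d → ℝ)), |signSGA μ ν c ε φ η y| ≤ M) ∧
    semiDual μ ν c ε (signSGA μ ν c ε φ η) ≥
      semiDual μ ν c ε φ + (η - η ^ 2 / 2) * (∫ y, |deltaJ μ ν c ε φ y|) ^ 2 ∧
    (∫ y, |deltaJ μ ν c ε φ y|) ≤ 2 := by
  have hμi : Integrable μ := by
    by_contra hn
    rw [integral_undef hn] at hμ1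
    exact zero_ne_one hμ1
  have hνi : Integrable ν := by
    by_contra hn
    rw [integral_undef hn] at hν1
    exact zero_ne_one hν1
  have hδm := measurable_deltaJ (ε := ε) hμm hνm hc hφm
  have hpi := integrable_piJoint hμ0 hν0 hμm hνm hμi hc hφm hpos
  have hYi : Integrable (piY μ ν c ε φ) := hpi.integral_prod_right
  have hY0 (y) : 0 ≤ piY μ ν c ε φ y := integral_nonneg fun x => by
    simp only [piJoint_eq, Pi.zero_apply]
    exact mul_nonneg (condDensity_nonneg hν0 x y) (hμ0 x)
  have hY1 : ∫ y, piY μ ν c ε φ y = 1 := by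
    simp only [piY]
    rw [← integral_integral_swap (f := fun x y => piJoint μ ν c ε φ (x, y)) hpi, ← hμ1]
    simp only [piJoint_eq, integral_mul_const, integral_condDensity (hpos _), one_mul]
  set L := ∫ y, |deltaJ μ ν c ε φ y| with hL
  have hL0 : 0 ≤ L := integral_nonneg fun y => abs_nonneg _
  have hηL : 0 ≤ η * L := mul_nonneg hη.le hL0
  set h : (Fin d → ℝ) → ℝ := fun y => η * L * Real.sign (deltaJ μ ν c ε φ y) with hh
  have hhm : Measurable h := (Real.measurable_sign.comp hδm).const_mul _
  have hH (y) : |h y| ≤ η * L := by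
    rw [hh, abs_mul, abs_of_nonneg hηL]
    exact mul_le_of_le_one_right hηL (Real.abs_sign_le_one _)
  have hφ' : signSGA μ ν c ε φ η = fun y => φ y + h y := rfl
  refine ⟨?_, ?_, ?_, ?_⟩
  · simp only [hφ', add_mul]
    exact hφν.add (hνi.bdd_mul hhm.aestronglyMeasurable (.of_forall hH))
  · obtain ⟨M, hM⟩ := hφbdd
    refine ⟨M + η * L, hM.mono fun y hy => ?_⟩
    exact (abs_add_le _ _).trans (add_le_add hy (hH y))
  · have key := semiDual_add_ge hμ0 hν0 hμm hνm hμ1 hμi hνi hc hφm hφν hpos hJ hhm hH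
    have hlin : ∫ y, h y * deltaJ μ ν c ε φ y = η * L * L := by
      simp only [hh, mul_assoc, Real.sign_mul_self_eq_abs, integral_const_mul]
      rw [← hL]
    rw [hφ', ge_iff_le]
    rw [hlin] at key
    linarith
  · have hmono : L ≤ ∫ y, (ν y + piY μ ν c ε φ y) := by
      refine integral_mono (hνi.sub hYi).abs (hνi.add hYi) fun y => ?_
      have := abs_sub (ν y) (piY μ ν c ε φ y)
      rwa [abs_of_nonneg (hν0 y), abs_of_nonneg (hY0 y)] at this
    rw [integral_add hνi hYi, hν1, hY1] at hmono
    linarith
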